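/- Let ≺ be an adequate order on the finite configurations of the symbolic unfolding of a safe high-level Petri net. Let C1, C2 be finite configurations, D a suffix of C1, and M ∈ Marks(C1) ∩ Marks(C2) a marking with C1⟦M⟧D, and let φ be the unique label-preserving monomorphism from O(C1|D) into ↑C2 with φ(Cut(C1)) = Cut(C2). Then C2 ≺ C1 implies C2 ⊕ φ(D) ≺ C1 ⊕ D. -/

import Mathlib

/-
Core formalization of high-level Petri nets, symbolic unfoldings,
branching processes, configurations, adequate orders, cut-off events,
expansions and constraints, following Würdemann–Chatain–Haar–Panneke,
"Taking Complete Finite Prefixes To High Level, Symbolically".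
-/

noncomputable section
open scoped Classical

/-- A high-level Petri net over a set `Color` of colors and a set `Var` of variables:
places, transitions, a flow function (given by the multisets of `(place, variable)`
pairs on the input resp. output arcs of each transition), a guard for each transition
(a predicate on the assignments of colors to variables), and a set of initial markings. -/
structure HLNet (Color : Type) (Var : Type) : Type 1 where
  Place : Type
  Trans : Type
  preFlow : Trans → Multiset (Place × Var)
  postFlow : Trans → Multiset (Place × Var)
  guard : Trans → (Var → Color) → Prop
  init : Set (Multiset (Place × Color))

namespace HLNet

variable {Color Var : Type}

/-- A marking: a multiset over `Place × Color`. -/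
abbrev Marking (N : HLNet Color Var) : Type := Multiset (N.Place × Color)

/-- Well-formedness: the set of initial markings is nonempty, and all initial markings
mark the same places with the same numbers of colors. -/
def WellFormed (N : HLNet Color Var) : Prop :=
  N.init.Nonempty ∧
    ∀ M ∈ N.init, ∀ M' ∈ N.init, Multiset.map Prod.fst M = Multiset.map Prod.fst M'

/-- The net is finite: finitely many places and transitions
(the support of the flow function is then automatically finite). -/
def NetFinite (N : HLNet Color Var) : Prop := Finite N.Place ∧ Finite N.Trans

/-- The guards are written in a decidable theory (stand-in: each guard is a
decidable predicate on modes). -/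
def DecidableGuards (N : HLNet Color Var) : Prop :=
  ∀ t σ, Nonempty (Decidable (N.guard t σ))

/-- `•(t,σ)`, the multiset of colored tokens consumed by transition `t` fired in mode `σ`. -/
def preMark (N : HLNet Color Var) (t : N.Trans) (σ : Var → Color) : N.Marking :=
  (N.preFlow t).map fun pv => (pv.1, σ pv.2)

/-- `(t,σ)•`, the multiset of colored tokens produced by transition `t` fired in mode `σ`. -/
def postMark (N : HLNet Color Var) (t : N.Trans) (σ : Var → Color) : N.Marking :=
  (N.postFlow t).map fun pv => (pv.1, σ pv.2)

/-- `M[t,σ⟩`: transition `t` can fire in mode `σ` from marking `M`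
(`σ` is a mode of `t`, i.e. the guard holds, and `•(t,σ) ≤ M`). -/
def fires (N : HLNet Color Var) (M : N.Marking) (t : N.Trans) (σ : Var → Color) : Prop :=
  N.guard t σ ∧ N.preMark t σ ≤ M

/-- `M[t,σ⟩M'`: firing `t` in mode `σ` from `M` yields `M'`. -/
def firesTo (N : HLNet Color Var) (M : N.Marking) (t : N.Trans) (σ : Var → Color)
    (M' : N.Marking) : Prop :=
  N.fires M t σ ∧ M' = (M - N.preMark t σ) + N.postMark t σ

/-- `R(N)`: the markings reachable from some initial marking by finitely many firings. -/
inductive Reach (N : HLNet Color Var) : N.Marking → Prop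
  | init {M : N.Marking} : M ∈ N.init → Reach N M
  | step {M : N.Marking} {t : N.Trans} {σ : Var → Color} {M' : N.Marking} :
      Reach N M → N.firesTo M t σ M' → Reach N M'

/-- The markings reachable in exactly `n` firings. -/
def ReachSteps (N : HLNet Color Var) : ℕ → N.Marking → Prop
  | 0, M => M ∈ N.init
  | n + 1, M' => ∃ M t σ, ReachSteps N n M ∧ N.firesTo M t σ M'

/-- Every reachable marking is reachable by firing at most `n` transitions. -/
def BoundedReach (N : HLNet Color Var) (n : ℕ) : Prop :=
  ∀ M, N.Reach M → ∃ k ≤ n, N.ReachSteps k M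

/-- Safety: in every reachable marking every place holds at most one color. -/
def Safe (N : HLNet Color Var) : Prop :=
  ∀ M, N.Reach M → ∀ p : N.Place, (M.filter fun pc => pc.1 = p).card ≤ 1

/-- Nodes of the net: places and transitions. -/
abbrev Node (N : HLNet Color Var) : Type := N.Place ⊕ N.Trans

/-- The arc relation `x → y` between nodes. -/
def arc (N : HLNet Color Var) : N.Node → N.Node → Prop
  | Sum.inl b, Sum.inr t => ∃ v, (b, v) ∈ N.preFlow t
  | Sum.inr t, Sum.inl b => ∃ v, (b, v) ∈ N.postFlow t
  | Sum.inl _, Sum.inl _ => False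
  | Sum.inr _, Sum.inr _ => False

/-- The causality relation `<` (irreflexive transitive closure of the arc relation). -/
def clt (N : HLNet Color Var) : N.Node → N.Node → Prop := Relation.TransGen N.arc

/-- The causality relation `≤` (reflexive transitive closure of the arc relation). -/
def cle (N : HLNet Color Var) : N.Node → N.Node → Prop := Relation.ReflTransGen N.arc

/-- `<` on transitions/events. -/
def evLT (N : HLNet Color Var) (e e' : N.Trans) : Prop := N.clt (Sum.inr e) (Sum.inr e')

/-- `≤` on transitions/events. -/
def evLE (N : HLNet Color Var) (e e' : N.Trans) : Prop := N.cle (Sum.inr e) (Sum.inr e')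

/-- Structural conflict `x ♯ y`: distinct transitions sharing an input place
causally precede `x` and `y` respectively. -/
def SConflict (N : HLNet Color Var) (x y : N.Node) : Prop :=
  ∃ (b : N.Place) (t1 t2 : N.Trans), t1 ≠ t2 ∧
    (∃ v, (b, v) ∈ N.preFlow t1) ∧ (∃ v, (b, v) ∈ N.preFlow t2) ∧
    N.cle (Sum.inr t1) x ∧ N.cle (Sum.inr t2) y

/-- Ordinariness: at most one arc connects any two nodes. -/
def Ordinary (N : HLNet Color Var) : Prop :=
  (∀ (t : N.Trans) (b : N.Place), ((N.preFlow t).filter fun pv => pv.1 = b).card ≤ 1) ∧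
  (∀ (t : N.Trans) (b : N.Place), ((N.postFlow t).filter fun pv => pv.1 = b).card ≤ 1)

/-- A high-level occurrence net: an ordinary well-formed high-level Petri net
(places = conditions, transitions = events) such that no event is in structural
self-conflict, no node is its own causal predecessor, causality is well-founded,
and each condition either has no incoming arc and is marked with exactly one color
in all initial cuts, or has a unique incoming arc and is unmarked in all initial cuts. -/
def IsOccNet (O : HLNet Color Var) : Prop :=
  O.WellFormed ∧ O.Ordinary ∧
  (∀ e : O.Trans, ¬ O.SConflict (Sum.inr e) (Sum.inr e)) ∧
  (∀ x : O.Node, ¬ O.clt x x) ∧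
  WellFounded O.clt ∧
  (∀ b : O.Place,
    ((∀ (e : O.Trans) (v : Var), (b, v) ∉ O.postFlow e) ∧
      ∀ K ∈ O.init, (K.filter fun bc => bc.1 = b).card = 1) ∨
    ((∃ (e : O.Trans) (v : Var), (b, v) ∈ O.postFlow e ∧
        ∀ (e' : O.Trans) (v' : Var), (b, v') ∈ O.postFlow e' → e' = e ∧ v' = v) ∧
      ∀ K ∈ O.init, (K.filter fun bc => bc.1 = b).card = 0))

/-- `•b = (e(b), v(b))`: the unique input event and arc-variable of a condition,
or `none` for the `⊥`-conditions (the conditions marked in all initial cuts). -/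
def condPre (O : HLNet Color Var) (b : O.Place) : Option (O.Trans × Var) :=
  if h : ∃ ev : O.Trans × Var, (b, ev.2) ∈ O.postFlow ev.1 then some h.choose else none

/-- An assignment of colors to the indexed variables: the variables `v_e` for events `e`
(`Sum.inl (e, v)`), and the variables `v^b_⊥` for conditions `b` (`Sum.inr b`). -/
abbrev Assign (O : HLNet Color Var) : Type := ((O.Trans × Var) ⊕ O.Place) → Color

/-- The color placed on condition `b` under assignment `ι`:
the value of `v(b)_{e(b)}`, resp. `v^b_⊥`. -/
def valOf (O : HLNet Color Var) (ι : O.Assign) (b : O.Place) : Color :=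
  match O.condPre b with
  | none => ι (Sum.inr b)
  | some ev => ι (Sum.inl ev)

/-- `pred(⊥)`: `ι` chooses one of the initial cuts. -/
def predBot (O : HLNet Color Var) (ι : O.Assign) : Prop :=
  ∃ K ∈ O.init, ∀ (b : O.Place) (c : Color), (b, c) ∈ K → ι (Sum.inr b) = c

/-- `loc(e)`: the local predicate of an event. -/
def locPred (O : HLNet Color Var) (e : O.Trans) (ι : O.Assign) : Prop :=
  O.guard e (fun v => ι (Sum.inl (e, v))) ∧
  ∀ bv ∈ O.preFlow e, ι (Sum.inl (e, bv.2)) = O.valOf ι bv.1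

/-- `pred(e) = pred(⊥) ∧ ⋀_{e' ≤ e} loc(e')`. -/
def pred (O : HLNet Color Var) (e : O.Trans) (ι : O.Assign) : Prop :=
  O.predBot ι ∧ ∀ e', O.evLE e' e → O.locPred e' ι

/-- `pred(e(b))` for a condition `b` (which is `pred(⊥)` for `⊥`-conditions). -/
def condPred (O : HLNet Color Var) (b : O.Place) (ι : O.Assign) : Prop :=
  match O.condPre b with
  | none => O.predBot ι
  | some ev => O.pred ev.1 ι

/-- An instantiation of a set `C` of events: an assignment satisfying `pred(e)` for
every `e ∈ C ∪ {⊥}`. -/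
def IsInst (O : HLNet Color Var) (C : Set O.Trans) (ι : O.Assign) : Prop :=
  O.predBot ι ∧ ∀ e ∈ C, O.pred e ι

/-- A configuration: a causally closed set of events free of structural conflict
and of color conflict. -/
def IsConfig (O : HLNet Color Var) (C : Set O.Trans) : Prop :=
  (∀ e ∈ C, ∀ e', O.evLE e' e → e' ∈ C) ∧
  (∀ e ∈ C, ∀ e' ∈ C, ¬ O.SConflict (Sum.inr e) (Sum.inr e')) ∧
  ∃ ι, O.IsInst C ι

/-- A finite configuration. -/
def FinCfg (O : HLNet Color Var) (C : Set O.Trans) : Prop := O.IsConfig C ∧ C.Finite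

/-- The cone configuration `[e] = {e' : e' ≤ e}` of an event. -/
def cone (O : HLNet Color Var) (e : O.Trans) : Set O.Trans := {e' | O.evLE e' e}

/-- `B0`: the conditions marked in all initial cuts (those with `•b = (⊥, v^b)`). -/
def B0 (O : HLNet Color Var) : Set O.Place := {b | O.condPre b = none}

/-- `C→`: the conditions in the postsets of the events of `C`. -/
def postConds (O : HLNet Color Var) (C : Set O.Trans) : Set O.Place :=
  {b | ∃ e ∈ C, ∃ v, (b, v) ∈ O.postFlow e}

/-- `→C`: the conditions in the presets of the events of `C`. -/
def preConds (O : HLNet Color Var) (C : Set O.Trans) : Set O.Place :=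
  {b | ∃ e ∈ C, ∃ v, (b, v) ∈ O.preFlow e}

/-- `Cut(C) = (B0 ∪ C→) \ →C`. -/
def cut (O : HLNet Color Var) (C : Set O.Trans) : Set O.Place :=
  (O.B0 ∪ O.postConds C) \ O.preConds C

/-- `Cut(C, ι)` as a marking of the occurrence net (requires `Cut(C)` to be finite). -/
def cutMark (O : HLNet Color Var) {C : Set O.Trans} (hfin : (O.cut C).Finite)
    (ι : O.Assign) : O.Marking :=
  hfin.toFinset.val.map fun b => (b, O.valOf ι b)

/-- `Cut(C, ι) = {(b, ι(v(b)_{e(b)})) : b ∈ Cut(C)}` as a set. -/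
def cutSet (O : HLNet Color Var) (C : Set O.Trans) (ι : O.Assign) : Set (O.Place × Color) :=
  {bc | bc.1 ∈ O.cut C ∧ bc.2 = O.valOf ι bc.1}

/-- `Cuts(C) = {Cut(C,ι) : ι ∈ I(C)}`. -/
def cuts (O : HLNet Color Var) (C : Set O.Trans) : Set (Set (O.Place × Color)) :=
  {K | ∃ ι, O.IsInst C ι ∧ K = O.cutSet C ι}

/-- `Cuts(C)` as a set of markings of the occurrence net. -/
def cutMarks (O : HLNet Color Var) (C : Set O.Trans) : Set O.Marking :=
  {K | ∃ ι, O.IsInst C ι ∧ ∃ hfin : (O.cut C).Finite, K = O.cutMark hfin ι}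

/-- A homomorphism of high-level nets: maps places to places and transitions to
transitions, preserving guards and the presets and postsets of transitions. -/
structure Hom (O N : HLNet Color Var) where
  mapP : O.Place → N.Place
  mapT : O.Trans → N.Trans
  guard_iff : ∀ (e : O.Trans) (σ : Var → Color), O.guard e σ ↔ N.guard (mapT e) σ
  pre_eq : ∀ e : O.Trans, N.preFlow (mapT e) = (O.preFlow e).map fun bv => (mapP bv.1, bv.2)
  post_eq : ∀ e : O.Trans, N.postFlow (mapT e) = (O.postFlow e).map fun bv => (mapP bv.1, bv.2)

/-- The image of a marking under a homomorphism. -/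
def Hom.mapMarking {O N : HLNet Color Var} (φ : Hom O N) (M : O.Marking) : N.Marking :=
  M.map fun bc => (φ.mapP bc.1, bc.2)

/-- An initial homomorphism: it maps the initial markings onto the initial markings. -/
def Hom.Initial {O N : HLNet Color Var} (φ : Hom O N) : Prop :=
  φ.mapMarking '' O.init = N.init

/-- `Mark(C, ι)`: the marking of `N` represented by the cut of an instantiated
configuration. -/
def mark {O N : HLNet Color Var} (h : Hom O N) {C : Set O.Trans}
    (hfin : (O.cut C).Finite) (ι : O.Assign) : N.Marking :=
  hfin.toFinset.val.map fun b => (h.mapP b, O.valOf ι b)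

/-- `Marks(C) = {Mark(C,ι) : ι ∈ I(C)}`. -/
def marks {O N : HLNet Color Var} (h : Hom O N) (C : Set O.Trans) : Set N.Marking :=
  {M | ∃ ι, O.IsInst C ι ∧ ∃ hfin : (O.cut C).Finite, M = mark h hfin ι}

/-- `(O, h)` is a symbolic branching process of `N`: `O` is an occurrence net all of
whose event predicates are satisfiable, and `h` is an initial homomorphism that is
injective on events with the same preset. -/
def IsSBP {O N : HLNet Color Var} (h : Hom O N) : Prop :=
  O.IsOccNet ∧ h.Initial ∧ (∀ e : O.Trans, ∃ ι, O.pred e ι) ∧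
  ∀ e e' : O.Trans, O.preFlow e = O.preFlow e' → h.mapT e = h.mapT e' → e = e'

/-- `(O1, h1)` is a prefix of `(O2, h2)`: there is an injective initial homomorphism
`φ : O1 → O2` with `h2 ∘ φ = h1`. -/
def IsPrefix {O1 O2 N : HLNet Color Var} (h1 : Hom O1 N) (h2 : Hom O2 N) : Prop :=
  ∃ φ : Hom O1 O2, φ.Initial ∧ Function.Injective φ.mapP ∧ Function.Injective φ.mapT ∧
    (∀ b, h2.mapP (φ.mapP b) = h1.mapP b) ∧ ∀ e, h2.mapT (φ.mapT e) = h1.mapT e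

/-- `(O, h)` is the symbolic unfolding `Υ(N)` of `N`: the (unique up to isomorphism)
maximal symbolic branching process of `N`. -/
def IsUnfolding {O N : HLNet Color Var} (h : Hom O N) : Prop :=
  IsSBP h ∧ ∀ (O' : HLNet Color Var) (h' : Hom O' N), IsSBP h' → IsPrefix h' h

/-- The net `N` with its set of initial markings replaced by `I`. -/
def withInit (N : HLNet Color Var) (I : Set N.Marking) : HLNet Color Var :=
  { N with init := I }

/-- Restriction of a marking to a subset of the places. -/
def restrictMark (O : HLNet Color Var) (SP : Set O.Place) (M : O.Marking) :
    Multiset (↥SP × Color) :=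
  M.filterMap fun bc => if h : bc.1 ∈ SP then some (⟨bc.1, h⟩, bc.2) else none

/-- The subnet of `O` on the places `SP` and transitions `ST`, with initial markings `I`. -/
def restrict (O : HLNet Color Var) (SP : Set O.Place) (ST : Set O.Trans)
    (I : Set (Multiset (↥SP × Color))) : HLNet Color Var where
  Place := ↥SP
  Trans := ↥ST
  preFlow e := (O.preFlow e.1).filterMap fun bv =>
    if h : bv.1 ∈ SP then some (⟨bv.1, h⟩, bv.2) else none
  postFlow e := (O.postFlow e.1).filterMap fun bv =>
    if h : bv.1 ∈ SP then some (⟨bv.1, h⟩, bv.2) else none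
  guard e σ := O.guard e.1 σ
  init := I

/-- The predicate contributed by a node to a color conflict:
`pred(e)` for an event `e`, `pred(e(b))` for a condition `b`. -/
def nodePred (O : HLNet Color Var) (x : O.Node) (ι : O.Assign) : Prop :=
  match x with
  | Sum.inl b => O.condPred b ι
  | Sum.inr e => O.pred e ι

/-- The nodes of the future `↑C`: nodes not in `C ∪ →C`, not in structural conflict
with any event of `C`, and not in color conflict together with `C`. -/
def futureNode (O : HLNet Color Var) (C : Set O.Trans) (x : O.Node) : Prop :=
  (match x with
   | Sum.inl b => b ∉ O.preConds C
   | Sum.inr e => e ∉ C) ∧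
  (∀ e' ∈ C, ¬ O.SConflict (Sum.inr e') x) ∧
  ∃ ι, O.IsInst C ι ∧ O.nodePred x ι

def futurePlaces (O : HLNet Color Var) (C : Set O.Trans) : Set O.Place :=
  {b | O.futureNode C (Sum.inl b)}

def futureEvents (O : HLNet Color Var) (C : Set O.Trans) : Set O.Trans :=
  {e | O.futureNode C (Sum.inr e)}

/-- The underlying net of the future `↑C` of a configuration `C`, with the cuts of `C`
as initial cuts. -/
def future (O : HLNet Color Var) (C : Set O.Trans) : HLNet Color Var :=
  O.restrict (O.futurePlaces C) (O.futureEvents C)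
    (O.restrictMark (O.futurePlaces C) '' O.cutMarks C)

def futPVal (O : HLNet Color Var) (C : Set O.Trans) : (O.future C).Place → O.Place :=
  fun b => b.1

def futTVal (O : HLNet Color Var) (C : Set O.Trans) : (O.future C).Trans → O.Trans :=
  fun e => e.1

/-- The conditions of the occurrence net `O(C|D)`: `Cut(C) ∪ →D ∪ D→`. -/
def aroundPlaces (O : HLNet Color Var) (C D : Set O.Trans) : Set O.Place :=
  O.cut C ∪ O.preConds D ∪ O.postConds D

/-- The occurrence net `O(C|D)` "around `D` from `Cut(C)`", with initial cuts `Cuts(C)`. -/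
def around (O : HLNet Color Var) (C D : Set O.Trans) : HLNet Color Var :=
  O.restrict (O.aroundPlaces C D) D
    (O.restrictMark (O.aroundPlaces C D) '' O.cutMarks C)

def arPVal (O : HLNet Color Var) (C D : Set O.Trans) : (O.around C D).Place → O.Place :=
  fun b => b.1

def arTVal (O : HLNet Color Var) (C D : Set O.Trans) : (O.around C D).Trans → O.Trans :=
  fun e => e.1

/-- `D` is a suffix of `C`, i.e. `C ⊕ D` is defined: `C` and `D` are disjoint and
`C ∪ D` is a configuration. -/
def IsSuffix (O : HLNet Color Var) (C D : Set O.Trans) : Prop :=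
  Disjoint C D ∧ O.IsConfig (C ∪ D)

/-- `C⟦M⟧D`: some instantiation of `C ⊕ D`, restricted to the variables of `C ∪ {⊥}`,
yields the marking `M` for `C`. -/
def markRel {O N : HLNet Color Var} (h : Hom O N) (C : Set O.Trans) (M : N.Marking)
    (D : Set O.Trans) : Prop :=
  ∃ ι, O.IsInst (C ∪ D) ι ∧ ∃ hfin : (O.cut C).Finite, mark h hfin ι = M

/-- `φ` is a monomorphism `O(C1|D) → ↑C2` preserving the labeling and mapping
`Cut(C1)` onto `Cut(C2)`. -/
def IsCanonMono {O N : HLNet Color Var} (h : Hom O N) (C1 D C2 : Set O.Trans)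
    (φ : Hom (O.around C1 D) (O.future C2)) : Prop :=
  Function.Injective φ.mapP ∧ Function.Injective φ.mapT ∧
  (∀ b, h.mapP (O.futPVal C2 (φ.mapP b)) = h.mapP (O.arPVal C1 D b)) ∧
  (∀ e, h.mapT (O.futTVal C2 (φ.mapT e)) = h.mapT (O.arTVal C1 D e)) ∧
  (fun b => O.futPVal C2 (φ.mapP b)) '' {b | O.arPVal C1 D b ∈ O.cut C1} = O.cut C2

/-- `φ(D)`: the image of the events `D` of `O(C1|D)` under `φ`, as a set of events of `O`. -/
def monoImageD {O : HLNet Color Var} (C1 D C2 : Set O.Trans)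
    (φ : Hom (O.around C1 D) (O.future C2)) : Set O.Trans :=
  {e | ∃ d, O.futTVal C2 (φ.mapT d) = e}

/-- An adequate order on the finite configurations of a symbolic branching process
`(O, h)`: a well-founded strict partial order refining set inclusion and preserved
by finite extensions (via the canonical monomorphism between the futures). -/
def IsAdequate {O N : HLNet Color Var} (h : Hom O N)
    (r : Set O.Trans → Set O.Trans → Prop) : Prop :=
  (∀ C, O.FinCfg C → ¬ r C C) ∧
  (∀ C1 C2 C3, O.FinCfg C1 → O.FinCfg C2 → O.FinCfg C3 → r C1 C2 → r C2 C3 → r C1 C3) ∧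
  WellFounded (fun a b : {C : Set O.Trans // O.FinCfg C} => r a.1 b.1) ∧
  (∀ C1 C2, O.FinCfg C1 → O.FinCfg C2 → C1 ⊂ C2 → r C1 C2) ∧
  (∀ C1 C2 D M, O.FinCfg C1 → O.FinCfg C2 → O.IsSuffix C1 D → D.Finite →
    M ∈ marks h C1 → M ∈ marks h C2 → markRel h C1 M D →
    ∀ φ : Hom (O.around C1 D) (O.future C2), IsCanonMono h C1 D C2 φ →
      r C1 C2 → r (C1 ∪ D) (C2 ∪ monoImageD C1 D C2 φ))

/-- A cut-off event: every marking of its cone configuration is represented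
by the cone configuration of a `≺`-smaller event. -/
def IsCutoff {O N : HLNet Color Var} (h : Hom O N)
    (r : Set O.Trans → Set O.Trans → Prop) (e : O.Trans) : Prop :=
  ∀ M ∈ marks h (O.cone e), ∃ e', r (O.cone e') (O.cone e) ∧ M ∈ marks h (O.cone e')

/-- A cut-off* event: every marking of its cone configuration is represented
by some `≺`-smaller finite configuration. -/
def IsCutoffStar {O N : HLNet Color Var} (h : Hom O N)
    (r : Set O.Trans → Set O.Trans → Prop) (e : O.Trans) : Prop :=
  ∀ M ∈ marks h (O.cone e), ∃ C, O.FinCfg C ∧ r C (O.cone e) ∧ M ∈ marks h C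

/-- The events of the prefix `Fin`: events whose cone contains no cut-off event other
than possibly the event itself. -/
def finEvents {O N : HLNet Color Var} (h : Hom O N)
    (r : Set O.Trans → Set O.Trans → Prop) : Set O.Trans :=
  {e | ∀ e' ∈ O.cone e, e' ≠ e → ¬ IsCutoff h r e'}

/-- The conditions of the prefix `Fin`: the conditions of `B0` and those in the
postsets of the events of `Fin`. -/
def finConds {O N : HLNet Color Var} (h : Hom O N)
    (r : Set O.Trans → Set O.Trans → Prop) : Set O.Place :=
  O.B0 ∪ {b | ∃ e ∈ finEvents h r, ∃ v, (b, v) ∈ O.postFlow e}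

/-- The events of the prefix `Fin` for the cut-off* criterion. -/
def finEventsStar {O N : HLNet Color Var} (h : Hom O N)
    (r : Set O.Trans → Set O.Trans → Prop) : Set O.Trans :=
  {e | ∀ e' ∈ O.cone e, e' ≠ e → ¬ IsCutoffStar h r e'}

/-- The conditions of the prefix `Fin` for the cut-off* criterion. -/
def finCondsStar {O N : HLNet Color Var} (h : Hom O N)
    (r : Set O.Trans → Set O.Trans → Prop) : Set O.Place :=
  O.B0 ∪ {b | ∃ e ∈ finEventsStar h r, ∃ v, (b, v) ∈ O.postFlow e}

/-- Completeness of the sub-branching-process of `(O,h)` on the events `E'`: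
every reachable marking `M` of `N` is `Mark(C,ι)` for a configuration `C ⊆ E'` and
an instantiation `ι ∈ I(C)` such that moreover every transition/mode firable from `M`
is matched by an event of `E'` firable from `Cut(C,ι)`. -/
def CompleteSub {O N : HLNet Color Var} (h : Hom O N) (E' : Set O.Trans) : Prop :=
  ∀ M, N.Reach M → ∃ C, O.IsConfig C ∧ C ⊆ E' ∧ ∃ ι, O.IsInst C ι ∧
    ∃ hfin : (O.cut C).Finite, M = mark h hfin ι ∧
      ∀ (t : N.Trans) (σ : Var → Color), N.fires M t σ →
        ∃ e ∈ E', h.mapT e = t ∧ O.fires (O.cutMark hfin ι) e σ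

/-- Completeness of the branching process `(O, h)`. -/
def Complete {O N : HLNet Color Var} (h : Hom O N) : Prop := CompleteSub h Set.univ

/-- The class `Nf`: finite safe high-level Petri nets with decidable guards and
finitely many reachable markings. -/
def InNf (N : HLNet Color Var) : Prop :=
  N.NetFinite ∧ N.WellFormed ∧ N.Safe ∧ N.DecidableGuards ∧ {M | N.Reach M}.Finite

/-- The class `Nsc` of symbolically compact nets: finite safe high-level Petri nets
with decidable guards admitting a bound on the number of transition firings needed
to reach every reachable marking. -/
def InNsc (N : HLNet Color Var) : Prop :=
  N.NetFinite ∧ N.WellFormed ∧ N.Safe ∧ N.DecidableGuards ∧ ∃ n, N.BoundedReach n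

/-- The modes of a transition. -/
def Mode (N : HLNet Color Var) (t : N.Trans) : Type := {σ : Var → Color // N.guard t σ}

/-- The expansion `Exp(N)`: the P/T Petri net (a high-level net over the trivial sets
of colors and variables) with places `p.c` and transitions `t.σ`. -/
def expand (N : HLNet Color Var) : HLNet Unit Unit where
  Place := N.Place × Color
  Trans := (t : N.Trans) × N.Mode t
  preFlow tσ := (N.preMark tσ.1 tσ.2.1).map fun pc => (pc, ())
  postFlow tσ := (N.postMark tσ.1 tσ.2.1).map fun pc => (pc, ())
  guard _ _ := True
  init := (fun M : N.Marking => M.map fun pc => (pc, ())) '' N.init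

def expPlaceBase (N : HLNet Color Var) : N.expand.Place → N.Place := fun pc => pc.1
def expPlaceColor (N : HLNet Color Var) : N.expand.Place → Color := fun pc => pc.2
def expTransBase (N : HLNet Color Var) : N.expand.Trans → N.Trans := fun tσ => tσ.1
def expTransMode (N : HLNet Color Var) (tσ : N.expand.Trans) : Var → Color := tσ.2.1

/-- The constraint `constr(B')` on a co-set `B'` of conditions, evaluated on an
assignment `a` of colors to the labels `π(B')` (predb(b) for all `b ∈ B'`,
with all bound indexed variables existentially quantified at once). -/
def constrSat {O N : HLNet Color Var} (h : Hom O N) (B' : Set O.Place)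
    (a : N.Place → Color) : Prop :=
  ∃ ι : O.Assign, ∀ b ∈ B', O.condPred b ι ∧ a (h.mapP b) = O.valOf ι b

/-- `φ(E')`: the multiset of the transition labels of a finite set of events. -/
def labelMS {O N : HLNet Color Var} (h : Hom O N) (S : Set O.Trans) : Multiset N.Trans :=
  if hfin : S.Finite then hfin.toFinset.val.map h.mapT else 0

/-- Lexicographic comparison of the `≪`-sorted sequences of two multisets. -/
def msLex {α : Type} (lo : LinearOrder α) (s1 s2 : Multiset α) : Prop :=
  letI := lo
  List.Lex (· < ·) (s1.sort (· ≤ ·)) (s2.sort (· ≤ ·))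

/-- `Min(S)`: the causally minimal events of `S`. -/
def minOf (O : HLNet Color Var) (S : Set O.Trans) : Set O.Trans :=
  {e | e ∈ S ∧ ∀ e' ∈ S, ¬ O.evLT e' e}

/-- What remains of `C` after removing the first `n` blocks of its Foata normal form. -/
def foataResidual (O : HLNet Color Var) (C : Set O.Trans) : ℕ → Set O.Trans
  | 0 => C
  | n + 1 => foataResidual O C n \ O.minOf (foataResidual O C n)

/-- The `n`-th block of the Foata normal form of `C`. -/
def foataBlock (O : HLNet Color Var) (C : Set O.Trans) (n : ℕ) : Set O.Trans :=
  O.minOf (O.foataResidual C n)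

/-- `FC1 ≪ FC2`: comparison of Foata normal forms. -/
def foataLex {O N : HLNet Color Var} (h : Hom O N) (lo : LinearOrder N.Trans)
    (C1 C2 : Set O.Trans) : Prop :=
  ∃ i : ℕ, (∀ j < i, labelMS h (O.foataBlock C1 j) = labelMS h (O.foataBlock C2 j)) ∧
    msLex lo (labelMS h (O.foataBlock C1 i)) (labelMS h (O.foataBlock C2 i))

/-- McMillan's order `≺_M`: comparison by size. -/
def rM {O : HLNet Color Var} (C1 C2 : Set O.Trans) : Prop := C1.ncard < C2.ncard

/-- The order `≺_E`: by size, then lexicographically on sorted label sequences. -/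
def rE {O N : HLNet Color Var} (h : Hom O N) (lo : LinearOrder N.Trans)
    (C1 C2 : Set O.Trans) : Prop :=
  C1.ncard < C2.ncard ∨
    (C1.ncard = C2.ncard ∧ msLex lo (labelMS h C1) (labelMS h C2))

/-- The total order `≺_F`: by size, then lexicographically on sorted label sequences,
then by Foata normal forms. -/
def rF {O N : HLNet Color Var} (h : Hom O N) (lo : LinearOrder N.Trans)
    (C1 C2 : Set O.Trans) : Prop :=
  C1.ncard < C2.ncard ∨
    (C1.ncard = C2.ncard ∧ msLex lo (labelMS h C1) (labelMS h C2)) ∨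
    (labelMS h C1 = labelMS h C2 ∧ foataLex h lo C1 C2)

end HLNet

namespace HLNet

variable {Color Var : Type} {N O : HLNet Color Var}

theorem IsOccNet.producer_unique (hO : O.IsOccNet) {b : O.Place} {e e' : O.Trans} {v v' : Var}
    (hb : (b, v) ∈ O.postFlow e) (hb' : (b, v') ∈ O.postFlow e') : e' = e ∧ v' = v := by
  rcases hO.2.2.2.2.2 b with ⟨hn, -⟩ | ⟨⟨e₀, v₀, -, huniq⟩, -⟩
  · exact absurd hb (hn e v)
  · obtain ⟨rfl, rfl⟩ := huniq _ _ hb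
    exact huniq _ _ hb'

theorem IsOccNet.condPre_eq_some (hO : O.IsOccNet) {b : O.Place} {e : O.Trans} {v : Var}
    (hb : (b, v) ∈ O.postFlow e) : O.condPre b = some (e, v) := by
  have hex : ∃ ev : O.Trans × Var, (b, ev.2) ∈ O.postFlow ev.1 := ⟨(e, v), hb⟩
  rw [condPre, dif_pos hex]
  obtain ⟨h1, h2⟩ := hO.producer_unique hb hex.choose_spec
  exact congrArg some (Prod.ext h1 h2)

theorem mem_B0_iff {b : O.Place} : b ∈ O.B0 ↔ ∀ e v, (b, v) ∉ O.postFlow e := by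
  constructor
  · intro hb e v hbv
    have hex : ∃ ev : O.Trans × Var, (b, ev.2) ∈ O.postFlow ev.1 := ⟨(e, v), hbv⟩
    rw [B0, Set.mem_ofPred_eq, condPre, dif_pos hex] at hb
    cases hb
  · intro hb
    rw [B0, Set.mem_ofPred_eq, condPre, dif_neg]
    rintro ⟨ev, hev⟩
    exact hb _ _ hev

theorem valOf_of_mem_B0 {b : O.Place} (hb : b ∈ O.B0) (ι : O.Assign) :
    O.valOf ι b = ι (Sum.inr b) := by
  rw [B0, Set.mem_ofPred_eq] at hb
  rw [valOf, hb]

theorem IsOccNet.valOf_of_mem_postFlow (hO : O.IsOccNet) {b : O.Place} {e : O.Trans} {v : Var}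
    (hb : (b, v) ∈ O.postFlow e) (ι : O.Assign) : O.valOf ι b = ι (Sum.inl (e, v)) := by
  rw [valOf, hO.condPre_eq_some hb]

theorem evLT_of_mem {b : O.Place} {e e' : O.Trans} {v v' : Var}
    (hpost : (b, v) ∈ O.postFlow e) (hpre : (b, v') ∈ O.preFlow e') : O.evLT e e' :=
  .tail (b := Sum.inl b) (.single ⟨v, hpost⟩) ⟨v', hpre⟩

theorem evLT.evLE {e e' : O.Trans} (he : O.evLT e e') : O.evLE e e' :=
  Relation.TransGen.to_reflTransGen he

/-- Closure under immediate causal predecessors implies causal closure. -/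
theorem mem_of_evLE_of_forall_mem {S : Set O.Trans}
    (hS : ∀ e ∈ S, ∀ b v e' v', (b, v) ∈ O.preFlow e → (b, v') ∈ O.postFlow e' → e' ∈ S)
    {e e' : O.Trans} (he : e ∈ S) (hle : O.evLE e' e) : e' ∈ S := by
  let motive : O.Node → Prop := fun x =>
    match x with
    | Sum.inl b => ∀ e' v, (b, v) ∈ O.postFlow e' → e' ∈ S
    | Sum.inr e => e ∈ S
  suffices hmot : motive (Sum.inr e') from hmot
  refine Relation.ReflTransGen.head_induction_on (motive := fun x _ => motive x) hle he ?_
  rintro (b | t) (b' | t') hab - hm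
  · exact hab.elim
  · obtain ⟨v, hv⟩ := hab
    exact fun e' v' hv' => hS t' hm b v e' v' hv hv'
  · obtain ⟨v, hv⟩ := hab
    exact hm t v hv
  · exact hab.elim

theorem exists_of_cle_place {b : O.Place} {t : O.Trans}
    (hle : O.cle (Sum.inr t) (Sum.inl b)) :
    ∃ e v, (b, v) ∈ O.postFlow e ∧ O.evLE t e := by
  rcases Relation.ReflTransGen.cases_tail hle with heq | ⟨x, hx, hxb⟩
  · cases heq
  · rcases x with b' | e
    · exact hxb.elim
    · obtain ⟨v, hv⟩ := hxb
      exact ⟨e, v, hv, hx⟩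

theorem SConflict.of_shared {b : O.Place} {e e' : O.Trans} {v v' : Var} (hne : e ≠ e')
    (he : (b, v) ∈ O.preFlow e) (he' : (b, v') ∈ O.preFlow e') :
    O.SConflict (Sum.inr e) (Sum.inr e') :=
  ⟨b, e, e', hne, ⟨v, he⟩, ⟨v', he'⟩, .refl, .refl⟩

theorem SConflict.mono_right {x y z : O.Node} (hc : O.SConflict x y) (hyz : O.cle y z) :
    O.SConflict x z := by
  obtain ⟨b, t1, t2, hne, h1, h2, hx, hy⟩ := hc
  exact ⟨b, t1, t2, hne, h1, h2, hx, hy.trans hyz⟩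

theorem IsConfig.eq_of_shared {C : Set O.Trans} (hC : O.IsConfig C) {b : O.Place}
    {e e' : O.Trans} {v v' : Var} (he : e ∈ C) (he' : e' ∈ C)
    (hb : (b, v) ∈ O.preFlow e) (hb' : (b, v') ∈ O.preFlow e') : e = e' := by
  by_contra hne
  exact hC.2.1 e he e' he' (.of_shared hne hb hb')

theorem IsConfig.mem_of_post_pre {C : Set O.Trans} (hC : O.IsConfig C) {b : O.Place}
    {e e' : O.Trans} {v v' : Var} (he : e ∈ C)
    (hb : (b, v) ∈ O.preFlow e) (hb' : (b, v') ∈ O.postFlow e') : e' ∈ C :=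
  hC.1 e he e' (evLT_of_mem hb' hb).evLE

theorem IsInst.mono {C C' : Set O.Trans} {ι : O.Assign} (hι : O.IsInst C ι) (hsub : C' ⊆ C) :
    O.IsInst C' ι :=
  ⟨hι.1, fun e he => hι.2 e (hsub he)⟩

theorem IsInst.locPred {C : Set O.Trans} {ι : O.Assign} (hι : O.IsInst C ι) {e : O.Trans}
    (he : e ∈ C) : O.locPred e ι :=
  (hι.2 e he).2 e .refl

theorem isInst_of_locPred {C : Set O.Trans} (hcl : ∀ e ∈ C, ∀ e', O.evLE e' e → e' ∈ C)
    {ι : O.Assign} (hbot : O.predBot ι) (hloc : ∀ e ∈ C, O.locPred e ι) : O.IsInst C ι :=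
  ⟨hbot, fun e he => ⟨hbot, fun e' hle => hloc e' (hcl e he e' hle)⟩⟩

theorem nodup_map_fst {α β : Type} {s : Multiset (α × β)}
    (hs : ∀ a, (s.filter fun x => x.1 = a).card ≤ 1) : (s.map Prod.fst).Nodup := by
  rw [Multiset.nodup_iff_count_le_one]
  intro a
  rw [Multiset.count_map]
  simpa only [eq_comm] using hs a

/-- The marking of `O` given by an initial cut chosen by an assignment. -/
theorem IsOccNet.init_eq_map (hO : O.IsOccNet) {K : O.Marking} (hK : K ∈ O.init)
    {ι : O.Assign} (hι : ∀ b c, (b, c) ∈ K → ι (Sum.inr b) = c) :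
    ∃ hfin : O.B0.Finite, K = hfin.toFinset.val.map fun b => (b, ι (Sum.inr b)) := by
  have hcard : ∀ b, (K.filter fun bc => bc.1 = b).card = if b ∈ O.B0 then 1 else 0 := by
    intro b
    rcases hO.2.2.2.2.2 b with ⟨hn, hc⟩ | ⟨⟨e, v, hb, -⟩, hc⟩
    · rw [if_pos (mem_B0_iff.2 hn), hc K hK]
    · rw [if_neg fun hb0 => mem_B0_iff.1 hb0 e v hb, hc K hK]
  have hnd : (K.map Prod.fst).Nodup := nodup_map_fst fun b => by
    rw [hcard]; split_ifs <;> simp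
  have hmem : ∀ b, b ∈ K.map Prod.fst ↔ b ∈ O.B0 := by
    intro b
    rw [← Multiset.count_pos, Multiset.count_map]
    have := hcard b
    simp only [eq_comm (a := b)]
    rw [this]
    split_ifs with hb <;> simp [hb]
  have hfin : O.B0.Finite :=
    (K.map Prod.fst).toFinset.finite_toSet.subset fun b hb => by simpa using (hmem b).2 hb
  refine ⟨hfin, ?_⟩
  have hval : hfin.toFinset.val = K.map Prod.fst := by
    refine (Multiset.Nodup.ext hfin.toFinset.nodup hnd).2 fun b => ?_
    rw [hmem, Finset.mem_val, Set.Finite.mem_toFinset]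
  rw [hval, Multiset.map_map]
  conv_lhs => rw [← Multiset.map_id K]
  exact Multiset.map_congr rfl fun bc hbc => Prod.ext rfl (hι bc.1 bc.2 hbc).symm

theorem cut_empty : O.cut ∅ = O.B0 := by
  ext b
  simp [cut, postConds, preConds]

theorem IsConfig.mem_cut_of_mem_preFlow {C : Set O.Trans} {e : O.Trans}
    (hC : O.IsConfig (insert e C)) (hO : O.IsOccNet) (he : e ∉ C) {b : O.Place} {v : Var}
    (hb : (b, v) ∈ O.preFlow e) : b ∈ O.cut C := by
  refine ⟨?_, ?_⟩
  · by_cases hb0 : b ∈ O.B0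
    · exact Or.inl hb0
    · rw [mem_B0_iff] at hb0
      push Not at hb0
      obtain ⟨e', v', hb'⟩ := hb0
      rcases hC.mem_of_post_pre (Set.mem_insert e C) hb hb' with rfl | he'
      · exact (hO.2.2.2.1 _ (evLT_of_mem hb' hb)).elim
      · exact Or.inr ⟨e', he', v', hb'⟩
  · rintro ⟨e', he', v', hb'⟩
    exact he (hC.eq_of_shared (Set.mem_insert e C) (Set.mem_insert_of_mem _ he') hb hb' ▸ he')

theorem IsOccNet.finset_val_pre (hO : O.IsOccNet) (e : O.Trans) :
    ((O.preFlow e).map Prod.fst).toFinset.val = (O.preFlow e).map Prod.fst :=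
  Multiset.dedup_eq_self.2 (nodup_map_fst (hO.2.1.1 e))

theorem IsOccNet.finset_val_post (hO : O.IsOccNet) (e : O.Trans) :
    ((O.postFlow e).map Prod.fst).toFinset.val = (O.postFlow e).map Prod.fst :=
  Multiset.dedup_eq_self.2 (nodup_map_fst (hO.2.1.2 e))

/-- Adding a causally maximal event to a configuration fires the corresponding transition
on the represented markings. -/
theorem mark_insert (h : Hom O N) (hO : O.IsOccNet) {C : Set O.Trans} {e : O.Trans}
    (hC : O.IsConfig (insert e C)) (he : e ∉ C) (hmax : ∀ e' ∈ C, ¬ O.evLT e e')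
    {ι : O.Assign} (hι : O.IsInst (insert e C) ι) (hfin : (O.cut C).Finite) :
    ∃ hfin' : (O.cut (insert e C)).Finite,
      N.firesTo (mark h hfin ι) (h.mapT e) (fun v => ι (Sum.inl (e, v))) (mark h hfin' ι) := by
  let P := ((O.preFlow e).map Prod.fst).toFinset
  let Q := ((O.postFlow e).map Prod.fst).toFinset
  have memP : ∀ b, b ∈ P ↔ ∃ v, (b, v) ∈ O.preFlow e := fun b => by simp [P]
  have memQ : ∀ b, b ∈ Q ↔ ∃ v, (b, v) ∈ O.postFlow e := fun b => by simp [Q]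
  have hPsub : P ⊆ hfin.toFinset := fun b hb => by
    obtain ⟨v, hv⟩ := (memP b).1 hb
    exact hfin.mem_toFinset.2 (hC.mem_cut_of_mem_preFlow hO he hv)
  have hset : O.cut (insert e C) = ↑((hfin.toFinset \ P) ∪ Q) := by
    ext b
    simp only [Finset.coe_union, Finset.coe_sdiff, Set.Finite.coe_toFinset, Set.mem_union,
      Set.mem_sdiff, Finset.mem_coe, memP, memQ]
    constructor
    · rintro ⟨hb, hnpre⟩
      have hnC : b ∉ O.preConds C := fun ⟨e', he', w⟩ => hnpre ⟨e', Or.inr he', w⟩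
      have hne : ¬ ∃ v, (b, v) ∈ O.preFlow e := fun w => hnpre ⟨e, Or.inl rfl, w⟩
      rcases hb with hb | ⟨e', rfl | he', w⟩
      · exact Or.inl ⟨⟨Or.inl hb, hnC⟩, hne⟩
      · exact Or.inr w
      · exact Or.inl ⟨⟨Or.inr ⟨e', he', w⟩, hnC⟩, hne⟩
    · rintro (⟨⟨hb, hnC⟩, hne⟩ | ⟨v, hv⟩)
      · refine ⟨hb.imp_right fun ⟨e', he', w⟩ => ⟨e', Or.inr he', w⟩, ?_⟩
        rintro ⟨e', rfl | he', w⟩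
        · exact hne w
        · exact hnC ⟨e', he', w⟩
      · refine ⟨Or.inr ⟨e, Or.inl rfl, v, hv⟩, ?_⟩
        rintro ⟨e', rfl | he', v', hv'⟩
        · exact hO.2.2.2.1 _ (evLT_of_mem hv hv')
        · exact hmax e' he' (evLT_of_mem hv hv')
  have hdisj : Disjoint (hfin.toFinset \ P) Q := by
    rw [Finset.disjoint_left]
    intro b hb hbQ
    obtain ⟨v, hv⟩ := (memQ b).1 hbQ
    rcases (hfin.mem_toFinset.1 (Finset.mem_sdiff.1 hb).1).1 with hb0 | ⟨e', he', v', hv'⟩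
    · exact mem_B0_iff.1 hb0 e v hv
    · obtain ⟨rfl, -⟩ := hO.producer_unique hv hv'
      exact he he'
  have hfin' : (O.cut (insert e C)).Finite := hset ▸ Finset.finite_toSet _
  have hval : hfin'.toFinset.val = (hfin.toFinset.val - P.val) + Q.val := by
    have hfs : hfin'.toFinset = (hfin.toFinset \ P).disjUnion Q hdisj := by
      rw [Finset.disjUnion_eq_union, ← Finset.coe_inj, Set.Finite.coe_toFinset, hset]
    rw [hfs, Finset.disjUnion_val, Finset.sdiff_val]
  have hPle : P.val ≤ hfin.toFinset.val := Finset.val_le_iff.2 hPsub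
  let f : O.Place → N.Place × Color := fun b => (h.mapP b, O.valOf ι b)
  have hpre : N.preMark (h.mapT e) (fun v => ι (Sum.inl (e, v))) = P.val.map f := by
    rw [preMark, h.pre_eq, Multiset.map_map, hO.finset_val_pre, Multiset.map_map]
    exact Multiset.map_congr rfl fun bv hbv =>
      Prod.ext rfl ((hι.locPred (Set.mem_insert e C)).2 bv hbv)
  have hpost : N.postMark (h.mapT e) (fun v => ι (Sum.inl (e, v))) = Q.val.map f := by
    rw [postMark, h.post_eq, Multiset.map_map, hO.finset_val_post, Multiset.map_map]
    exact Multiset.map_congr rfl fun bv hbv =>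
      Prod.ext rfl (hO.valOf_of_mem_postFlow (v := bv.2) hbv ι).symm
  have hmark : mark h hfin ι = (hfin.toFinset.val - P.val).map f + P.val.map f := by
    rw [← Multiset.map_add, Multiset.sub_add_cancel hPle]
    rfl
  refine ⟨hfin', ⟨(h.guard_iff e _).1 (hι.locPred (Set.mem_insert e C)).1, ?_⟩, ?_⟩
  · rw [hpre, hmark]
    exact Multiset.le_add_left _ _
  · rw [hpre, hpost, hmark, Multiset.add_sub_cancel_right, ← Multiset.map_add, ← hval]
    rfl

theorem exists_maximal_event (hO : O.IsOccNet) {C : Set O.Trans} (hfin : C.Finite)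
    (hne : C.Nonempty) : ∃ e ∈ C, ∀ e' ∈ C, ¬ O.evLT e e' := by
  have := hfin.to_subtype
  let rel : C → C → Prop := fun a b => O.evLT b.1 a.1
  have : IsTrans C rel := ⟨fun a b c hab hbc => Relation.TransGen.trans hbc hab⟩
  have : Std.Irrefl rel := ⟨fun a => hO.2.2.2.1 _⟩
  obtain ⟨e, -, he⟩ := (Finite.wellFounded_of_trans_of_irrefl rel).has_min Set.univ
    ⟨⟨_, hne.some_mem⟩, trivial⟩
  exact ⟨e.1, e.2, fun e' he' => he ⟨e', he'⟩ trivial⟩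

/-- The marking represented by an instantiated finite configuration is reachable. -/
theorem reach_mark {h : Hom O N} (hO : O.IsOccNet) (hinit : h.Initial) {C : Set O.Trans}
    (hC : O.FinCfg C) {ι : O.Assign} (hι : O.IsInst C ι) :
    ∃ hfin : (O.cut C).Finite, N.Reach (mark h hfin ι) := by
  induction hn : C.ncard generalizing C with
  | zero =>
    obtain rfl := (Set.ncard_eq_zero hC.2).1 hn
    obtain ⟨K, hK, hKι⟩ := hι.1
    obtain ⟨hfin, hKeq⟩ := hO.init_eq_map hK hKι
    refine ⟨cut_empty (O := O) ▸ hfin, .init ?_⟩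
    rw [← hinit]
    refine ⟨K, hK, ?_⟩
    rw [hKeq, Hom.mapMarking, Multiset.map_map, mark]
    simp only [cut_empty]
    refine Multiset.map_congr rfl fun b hb => ?_
    rw [valOf_of_mem_B0 (hfin.mem_toFinset.1 hb)]
    rfl
  | succ n ih =>
    obtain ⟨e, he, hmax⟩ := exists_maximal_event hO hC.2
      (Set.nonempty_of_ncard_ne_zero (hn ▸ n.succ_ne_zero))
    obtain ⟨C', hCeq, heC'⟩ : ∃ C', insert e C' = C ∧ e ∉ C' :=
      ⟨C \ {e}, Set.insert_sdiff_self_of_mem he, fun hmem => hmem.2 rfl⟩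
    subst hCeq
    have hsub : C' ⊆ insert e C' := Set.subset_insert _ _
    have hC' : O.FinCfg C' := by
      refine ⟨⟨fun a ha a' hle => ?_, fun a ha b hb => hC.1.2.1 a (hsub ha) b (hsub hb),
        ι, hι.mono hsub⟩, hC.2.subset hsub⟩
      refine (hC.1.1 a (hsub ha) a' hle).resolve_left ?_
      rintro rfl
      rcases Relation.reflTransGen_iff_eq_or_transGen.1 hle with heq | hlt
      · exact heC' (Sum.inr.inj heq ▸ ha)
      · exact hmax a (hsub ha) hlt
    have hcard : C'.ncard = n := by
      rw [Set.ncard_insert_of_notMem heC' hC'.2] at hn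
      exact Nat.succ.inj hn
    obtain ⟨hfin, hreach⟩ := ih hC' (hι.mono hsub) hcard
    obtain ⟨hfin', hfire⟩ := mark_insert h hO hC.1 heC' (fun a ha => hmax a (hsub ha)) hι hfin
    exact ⟨hfin', hreach.step hfire⟩

theorem map_val_filterMap {α β : Type} {S : Set α} {s : Multiset (α × β)}
    (hs : ∀ x ∈ s, x.1 ∈ S) :
    ((s.filterMap fun x => if h : x.1 ∈ S then some ((⟨x.1, h⟩ : S), x.2) else none).map
      fun x => (x.1.1, x.2)) = s := by
  induction s using Multiset.induction_on with
  | empty => rfl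
  | cons x s ih =>
    rw [Multiset.filterMap_cons_some _ _ _ (dif_pos (hs x (Multiset.mem_cons_self x s))),
      Multiset.map_cons, ih fun y hy => hs y (Multiset.mem_cons_of_mem hy)]

theorem map_injective_of_fst {α β γ : Type} {f : α → γ} (hf : Function.Injective f) :
    Function.Injective (Multiset.map fun x : α × β => (f x.1, x.2)) :=
  Multiset.map_injective fun _ _ hxy =>
    Prod.ext (hf (Prod.ext_iff.1 hxy).1) (Prod.ext_iff.1 hxy).2

theorem arPVal_injective {C D : Set O.Trans} : Function.Injective (O.arPVal C D) :=
  Subtype.val_injective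

theorem arTVal_injective {C D : Set O.Trans} : Function.Injective (O.arTVal C D) :=
  Subtype.val_injective

theorem futPVal_injective {C : Set O.Trans} : Function.Injective (O.futPVal C) :=
  Subtype.val_injective

theorem futTVal_injective {C : Set O.Trans} : Function.Injective (O.futTVal C) :=
  Subtype.val_injective

theorem map_val_around_preFlow {C D : Set O.Trans} (d : (O.around C D).Trans) :
    (((O.around C D).preFlow d).map fun x => (O.arPVal C D x.1, x.2)) =
      O.preFlow (O.arTVal C D d) :=
  map_val_filterMap fun x hx => Or.inl (Or.inr ⟨d.1, d.2, x.2, hx⟩)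

theorem map_val_around_postFlow {C D : Set O.Trans} (d : (O.around C D).Trans) :
    (((O.around C D).postFlow d).map fun x => (O.arPVal C D x.1, x.2)) =
      O.postFlow (O.arTVal C D d) :=
  map_val_filterMap fun x hx => Or.inr ⟨d.1, d.2, x.2, hx⟩

theorem mem_futurePlaces_of_mem_preFlow {C : Set O.Trans} {e : O.Trans} (hO : O.IsOccNet)
    (he : e ∈ O.futureEvents C) {b : O.Place} {v : Var} (hb : (b, v) ∈ O.preFlow e) :
    b ∈ O.futurePlaces C := by
  obtain ⟨hnot, hconf, ι, hι, hpred⟩ := he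
  refine ⟨?_, fun e' he' hc => hconf e' he' (hc.mono_right (.single ⟨v, hb⟩)), ι, hι, ?_⟩
  · rintro ⟨e', he', v', hb'⟩
    exact hconf e' he' (.of_shared (fun heq => hnot (heq ▸ he')) hb' hb)
  · change O.condPred b ι
    by_cases hb0 : b ∈ O.B0
    · rw [condPred, show O.condPre b = none from hb0]
      exact hι.1
    · rw [mem_B0_iff] at hb0
      push Not at hb0
      obtain ⟨e', v', hb'⟩ := hb0
      rw [condPred, hO.condPre_eq_some hb']
      exact ⟨hι.1, fun a ha => hpred.2 a (ha.trans (evLT_of_mem hb' hb).evLE)⟩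

theorem mem_futurePlaces_of_mem_postFlow {C : Set O.Trans} {e : O.Trans} (hO : O.IsOccNet)
    (hC : O.IsConfig C) (he : e ∈ O.futureEvents C) {b : O.Place} {v : Var}
    (hb : (b, v) ∈ O.postFlow e) : b ∈ O.futurePlaces C := by
  obtain ⟨hnot, hconf, ι, hι, hpred⟩ := he
  refine ⟨?_, ?_, ι, hι, ?_⟩
  · rintro ⟨e', he', v', hb'⟩
    exact hnot (hC.mem_of_post_pre he' hb' hb)
  · rintro e' he' ⟨c, t1, t2, hne, h1, h2, hx, hy⟩
    obtain ⟨e₁, v₁, hb₁, hle⟩ := exists_of_cle_place hy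
    obtain ⟨rfl, -⟩ := hO.producer_unique hb hb₁
    exact hconf e' he' ⟨c, t1, t2, hne, h1, h2, hx, hle⟩
  · change O.condPred b ι
    rw [condPred, hO.condPre_eq_some hb]
    exact hpred

theorem mem_futurePlaces_of_mem_cut {C : Set O.Trans} (hO : O.IsOccNet) (hC : O.IsConfig C)
    {b : O.Place} (hb : b ∈ O.cut C) : b ∈ O.futurePlaces C := by
  obtain ⟨ι, hι⟩ := hC.2.2
  refine ⟨hb.2, ?_, ι, hι, ?_⟩
  · rintro e' he' ⟨c, t1, t2, hne, h1, h2, hx, hy⟩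
    obtain ⟨e₁, v₁, hb₁, hle⟩ := exists_of_cle_place hy
    rcases hb.1 with hb0 | ⟨e₂, he₂, v₂, hb₂⟩
    · exact mem_B0_iff.1 hb0 _ _ hb₁
    · obtain ⟨rfl, -⟩ := hO.producer_unique hb₂ hb₁
      exact hC.2.1 e' he' _ he₂ ⟨c, t1, t2, hne, h1, h2, hx, hle⟩
  · change O.condPred b ι
    rcases hb.1 with hb0 | ⟨e₂, he₂, v₂, hb₂⟩
    · rw [condPred, show O.condPre b = none from hb0]
      exact hι.1
    · rw [condPred, hO.condPre_eq_some hb₂]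
      exact hι.2 _ he₂

theorem map_val_future_preFlow {C : Set O.Trans} (hO : O.IsOccNet) (e : (O.future C).Trans) :
    (((O.future C).preFlow e).map fun x => (O.futPVal C x.1, x.2)) =
      O.preFlow (O.futTVal C e) :=
  map_val_filterMap fun x hx => mem_futurePlaces_of_mem_preFlow hO e.2 (v := x.2) hx

theorem map_val_future_postFlow {C : Set O.Trans} (hO : O.IsOccNet) (hC : O.IsConfig C)
    (e : (O.future C).Trans) :
    (((O.future C).postFlow e).map fun x => (O.futPVal C x.1, x.2)) =
      O.postFlow (O.futTVal C e) :=
  map_val_filterMap fun x hx => mem_futurePlaces_of_mem_postFlow hO hC e.2 (v := x.2) hx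

theorem IsSuffix.mem_cut_or_mem_postConds {C D : Set O.Trans} (hD : O.IsSuffix C D)
    {d : O.Trans} (hd : d ∈ D) {b : O.Place} {v : Var}
    (hb : (b, v) ∈ O.preFlow d) : b ∈ O.cut C ∨ b ∈ O.postConds D := by
  have hnpre : b ∉ O.preConds C := by
    rintro ⟨e, he, v', hb'⟩
    obtain rfl := hD.2.eq_of_shared (Or.inl he) (Or.inr hd) hb' hb
    exact Set.disjoint_left.1 hD.1 he hd
  by_cases hb0 : b ∈ O.B0
  · exact Or.inl ⟨Or.inl hb0, hnpre⟩
  · rw [mem_B0_iff] at hb0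
    push Not at hb0
    obtain ⟨e, v', hb'⟩ := hb0
    rcases hD.2.mem_of_post_pre (Or.inr hd) hb hb' with he | he
    · exact Or.inl ⟨Or.inr ⟨e, he, v', hb'⟩, hnpre⟩
    · exact Or.inr ⟨e, he, v', hb'⟩

theorem IsSuffix.mem_futureEvents {C D : Set O.Trans} (hD : O.IsSuffix C D)
    {d : O.Trans} (hd : d ∈ D) : d ∈ O.futureEvents C := by
  obtain ⟨ι, hι⟩ := hD.2.2.2
  exact ⟨fun hC => Set.disjoint_left.1 hD.1 hC hd,
    fun e he => hD.2.2.1 e (Or.inl he) d (Or.inr hd),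
    ι, hι.mono Set.subset_union_left, hι.2 d (Or.inr hd)⟩

theorem IsSuffix.aroundPlaces_subset {C D : Set O.Trans} (hO : O.IsOccNet)
    (hC : O.IsConfig C) (hD : O.IsSuffix C D) : O.aroundPlaces C D ⊆ O.futurePlaces C := by
  rintro b ((hb | ⟨d, hd, v, hb⟩) | ⟨d, hd, v, hb⟩)
  · exact mem_futurePlaces_of_mem_cut hO hC hb
  · exact mem_futurePlaces_of_mem_preFlow hO (hD.mem_futureEvents hd) hb
  · exact mem_futurePlaces_of_mem_postFlow hO hC (hD.mem_futureEvents hd) hb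

section Mono

variable {C1 C2 D : Set O.Trans} (φ : Hom (O.around C1 D) (O.future C2))

theorem preFlow_mono (hO : O.IsOccNet) (d : (O.around C1 D).Trans) :
    O.preFlow (O.futTVal C2 (φ.mapT d)) =
      ((O.around C1 D).preFlow d).map fun x => (O.futPVal C2 (φ.mapP x.1), x.2) := by
  rw [← map_val_future_preFlow hO, φ.pre_eq, Multiset.map_map]
  rfl

theorem postFlow_mono (hO : O.IsOccNet) (hC2 : O.IsConfig C2) (d : (O.around C1 D).Trans) :
    O.postFlow (O.futTVal C2 (φ.mapT d)) =
      ((O.around C1 D).postFlow d).map fun x => (O.futPVal C2 (φ.mapP x.1), x.2) := by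
  rw [← map_val_future_postFlow hO hC2, φ.post_eq, Multiset.map_map]
  rfl

theorem exists_of_mem_preFlow_mono (hO : O.IsOccNet) {d : (O.around C1 D).Trans}
    {b' : O.Place} {v : Var} (hb' : (b', v) ∈ O.preFlow (O.futTVal C2 (φ.mapT d))) :
    ∃ b : (O.around C1 D).Place, O.futPVal C2 (φ.mapP b) = b' ∧
      (O.arPVal C1 D b, v) ∈ O.preFlow (O.arTVal C1 D d) := by
  rw [preFlow_mono φ hO, Multiset.mem_map] at hb'
  obtain ⟨x, hx, heq⟩ := hb'
  obtain ⟨rfl, rfl⟩ := Prod.ext_iff.1 heq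
  refine ⟨x.1, rfl, ?_⟩
  rw [← map_val_around_preFlow, Multiset.mem_map]
  exact ⟨x, hx, rfl⟩

theorem exists_of_mem_postFlow_mono (hO : O.IsOccNet) (hC2 : O.IsConfig C2)
    {d : (O.around C1 D).Trans} {b' : O.Place} {v : Var}
    (hb' : (b', v) ∈ O.postFlow (O.futTVal C2 (φ.mapT d))) :
    ∃ b : (O.around C1 D).Place, O.futPVal C2 (φ.mapP b) = b' ∧
      (O.arPVal C1 D b, v) ∈ O.postFlow (O.arTVal C1 D d) := by
  rw [postFlow_mono φ hO hC2, Multiset.mem_map] at hb'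
  obtain ⟨x, hx, heq⟩ := hb'
  obtain ⟨rfl, rfl⟩ := Prod.ext_iff.1 heq
  refine ⟨x.1, rfl, ?_⟩
  rw [← map_val_around_postFlow, Multiset.mem_map]
  exact ⟨x, hx, rfl⟩

theorem mem_preFlow_mono (hO : O.IsOccNet) {d : (O.around C1 D).Trans}
    {b : (O.around C1 D).Place} {v : Var}
    (hb : (O.arPVal C1 D b, v) ∈ O.preFlow (O.arTVal C1 D d)) :
    (O.futPVal C2 (φ.mapP b), v) ∈ O.preFlow (O.futTVal C2 (φ.mapT d)) := by
  rw [← map_val_around_preFlow, Multiset.mem_map] at hb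
  obtain ⟨x, hx, heq⟩ := hb
  obtain rfl : x = (b, v) :=
    Prod.ext (arPVal_injective (Prod.ext_iff.1 heq).1) (Prod.ext_iff.1 heq).2
  rw [preFlow_mono φ hO, Multiset.mem_map]
  exact ⟨_, hx, rfl⟩

theorem mem_postFlow_mono (hO : O.IsOccNet) (hC2 : O.IsConfig C2)
    {d : (O.around C1 D).Trans} {b : (O.around C1 D).Place} {v : Var}
    (hb : (O.arPVal C1 D b, v) ∈ O.postFlow (O.arTVal C1 D d)) :
    (O.futPVal C2 (φ.mapP b), v) ∈ O.postFlow (O.futTVal C2 (φ.mapT d)) := by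
  rw [← map_val_around_postFlow, Multiset.mem_map] at hb
  obtain ⟨x, hx, heq⟩ := hb
  obtain rfl : x = (b, v) :=
    Prod.ext (arPVal_injective (Prod.ext_iff.1 heq).1) (Prod.ext_iff.1 heq).2
  rw [postFlow_mono φ hO hC2, Multiset.mem_map]
  exact ⟨_, hx, rfl⟩

theorem monoImageD_mem (d : (O.around C1 D).Trans) :
    O.futTVal C2 (φ.mapT d) ∈ monoImageD C1 D C2 φ :=
  ⟨d, rfl⟩

theorem disjoint_monoImageD : Disjoint C2 (monoImageD C1 D C2 φ) := by
  rw [Set.disjoint_left]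
  rintro _ he ⟨d, rfl⟩
  exact (φ.mapT d).2.1 he

theorem monoImageD_finite (hfin : D.Finite) : (monoImageD C1 D C2 φ).Finite := by
  have : Finite (O.around C1 D).Trans := hfin.to_subtype
  exact Set.finite_range fun d => O.futTVal C2 (φ.mapT d)

variable {φ} {h : Hom O N}

theorem IsCanonMono.mem_cut (hφ : IsCanonMono h C1 D C2 φ) {b : (O.around C1 D).Place}
    (hb : O.arPVal C1 D b ∈ O.cut C1) : O.futPVal C2 (φ.mapP b) ∈ O.cut C2 :=
  hφ.2.2.2.2 ▸ ⟨b, hb, rfl⟩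

theorem IsCanonMono.futPVal_comp_injective (hφ : IsCanonMono h C1 D C2 φ) :
    Function.Injective fun b => O.futPVal C2 (φ.mapP b) :=
  futPVal_injective.comp hφ.1

theorem IsCanonMono.futTVal_comp_injective (hφ : IsCanonMono h C1 D C2 φ) :
    Function.Injective fun d => O.futTVal C2 (φ.mapT d) :=
  futTVal_injective.comp hφ.2.1

theorem IsCanonMono.causally_closed (hφ : IsCanonMono h C1 D C2 φ) (hO : O.IsOccNet)
    (hC2 : O.IsConfig C2) (hD : O.IsSuffix C1 D) :
    ∀ e ∈ C2 ∪ monoImageD C1 D C2 φ, ∀ e', O.evLE e' e → e' ∈ C2 ∪ monoImageD C1 D C2 φ := by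
  intro e he e' hle
  refine mem_of_evLE_of_forall_mem ?_ he hle
  rintro e (he | ⟨d, rfl⟩) b v e' v' hpre hpost
  · exact Or.inl (hC2.mem_of_post_pre he hpre hpost)
  · obtain ⟨b, rfl, hb⟩ := exists_of_mem_preFlow_mono φ hO hpre
    rcases hD.mem_cut_or_mem_postConds d.2 hb with hcut | ⟨d', hd', w, hw⟩
    · rcases (hφ.mem_cut hcut).1 with hb0 | ⟨e₂, he₂, v₂, hb₂⟩
      · exact (mem_B0_iff.1 hb0 _ _ hpost).elim
      · obtain ⟨rfl, -⟩ := hO.producer_unique hb₂ hpost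
        exact Or.inl he₂
    · obtain ⟨rfl, -⟩ := hO.producer_unique
        (mem_postFlow_mono φ hO hC2 (d := ⟨d', hd'⟩) hw) hpost
      exact Or.inr (monoImageD_mem φ _)

theorem IsCanonMono.conflict_free (hφ : IsCanonMono h C1 D C2 φ) (hO : O.IsOccNet)
    (hC2 : O.IsConfig C2) (hD : O.IsSuffix C1 D) :
    ∀ e ∈ C2 ∪ monoImageD C1 D C2 φ, ∀ e' ∈ C2 ∪ monoImageD C1 D C2 φ,
      ¬ O.SConflict (Sum.inr e) (Sum.inr e') := by
  rintro e he e' he' ⟨b, t1, t2, hne, ⟨v1, h1⟩, ⟨v2, h2⟩, hle1, hle2⟩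
  have hcl := hφ.causally_closed hO hC2 hD
  rcases hcl e he t1 hle1 with ht1 | ⟨d1, rfl⟩ <;> rcases hcl e' he' t2 hle2 with ht2 | ⟨d2, rfl⟩
  · exact hne (hC2.eq_of_shared ht1 ht2 h1 h2)
  · exact (φ.mapT d2).2.2.1 t1 ht1 (.of_shared hne h1 h2)
  · exact (φ.mapT d1).2.2.1 t2 ht2 (.of_shared hne.symm h2 h1)
  · obtain ⟨b1, rfl, hb1⟩ := exists_of_mem_preFlow_mono φ hO h1
    obtain ⟨b2, hb, hb2⟩ := exists_of_mem_preFlow_mono φ hO h2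
    obtain rfl := hφ.futPVal_comp_injective hb
    refine hne ?_
    rw [Subtype.ext (hD.2.eq_of_shared (Or.inr d1.2) (Or.inr d2.2) hb1 hb2)]

end Mono

/-- The assignment that follows `ι1` on the variables of `φ(D)` and `ι2` on all others. -/
def glueAssign {C1 C2 D : Set O.Trans} (φ : Hom (O.around C1 D) (O.future C2))
    (ι1 ι2 : O.Assign) : O.Assign
  | Sum.inl (e, v) =>
    if he : ∃ d, O.futTVal C2 (φ.mapT d) = e then ι1 (Sum.inl (O.arTVal C1 D he.choose, v))
    else ι2 (Sum.inl (e, v))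
  | Sum.inr b => ι2 (Sum.inr b)

section Glue

variable {C1 C2 D : Set O.Trans} {φ : Hom (O.around C1 D) (O.future C2)} {h : Hom O N}

theorem IsCanonMono.glueAssign_mapT (hφ : IsCanonMono h C1 D C2 φ) (ι1 ι2 : O.Assign)
    (d : (O.around C1 D).Trans) (v : Var) :
    glueAssign φ ι1 ι2 (Sum.inl (O.futTVal C2 (φ.mapT d), v)) =
      ι1 (Sum.inl (O.arTVal C1 D d, v)) := by
  have hex : ∃ d', O.futTVal C2 (φ.mapT d') = O.futTVal C2 (φ.mapT d) := ⟨d, rfl⟩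
  rw [glueAssign, dif_pos hex, hφ.futTVal_comp_injective hex.choose_spec]

theorem glueAssign_of_mem (ι1 ι2 : O.Assign) {e : O.Trans} (he : e ∈ C2) (v : Var) :
    glueAssign φ ι1 ι2 (Sum.inl (e, v)) = ι2 (Sum.inl (e, v)) := by
  rw [glueAssign, dif_neg]
  exact fun hex => Set.disjoint_left.1 (disjoint_monoImageD φ) he hex

theorem valOf_glueAssign (hO : O.IsOccNet) (ι1 ι2 : O.Assign) {b : O.Place}
    (hb : b ∈ O.B0 ∪ O.postConds C2) :
    O.valOf (glueAssign φ ι1 ι2) b = O.valOf ι2 b := by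
  rcases hb with hb | ⟨e, he, v, hb⟩
  · rw [valOf_of_mem_B0 hb, valOf_of_mem_B0 hb]
    rfl
  · rw [hO.valOf_of_mem_postFlow hb, hO.valOf_of_mem_postFlow hb, glueAssign_of_mem ι1 ι2 he]

theorem mark_glueAssign (hO : O.IsOccNet) (ι1 ι2 : O.Assign) (hfin : (O.cut C2).Finite) :
    mark h hfin (glueAssign φ ι1 ι2) = mark h hfin ι2 :=
  Multiset.map_congr rfl fun _ hb =>
    Prod.ext rfl (valOf_glueAssign hO ι1 ι2 (hfin.mem_toFinset.1 hb).1)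

theorem IsCanonMono.isInst_glueAssign (hφ : IsCanonMono h C1 D C2 φ) (hO : O.IsOccNet)
    (hC2 : O.IsConfig C2) (hD : O.IsSuffix C1 D) {ι1 ι2 : O.Assign}
    (hι1 : O.IsInst (C1 ∪ D) ι1) (hι2 : O.IsInst C2 ι2)
    (hcut : ∀ b, O.arPVal C1 D b ∈ O.cut C1 →
      O.valOf ι1 (O.arPVal C1 D b) = O.valOf ι2 (O.futPVal C2 (φ.mapP b))) :
    O.IsInst (C2 ∪ monoImageD C1 D C2 φ) (glueAssign φ ι1 ι2) := by
  refine isInst_of_locPred (hφ.causally_closed hO hC2 hD) hι2.1 ?_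
  rintro e (he | ⟨d, rfl⟩)
  · obtain ⟨hg, hpre⟩ := hι2.locPred he
    refine ⟨?_, fun bv hbv => ?_⟩
    · simpa only [glueAssign_of_mem ι1 ι2 he] using hg
    · rw [glueAssign_of_mem ι1 ι2 he, hpre bv hbv, valOf_glueAssign hO]
      by_cases hb0 : bv.1 ∈ O.B0
      · exact Or.inl hb0
      · rw [mem_B0_iff] at hb0
        push Not at hb0
        obtain ⟨e', v', hb'⟩ := hb0
        exact Or.inr ⟨e', hC2.mem_of_post_pre (v := bv.2) he hbv hb', v', hb'⟩
  · obtain ⟨hg, hpre⟩ := hι1.locPred (Or.inr d.2)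
    refine ⟨?_, ?_⟩
    · simp only [hφ.glueAssign_mapT]
      exact (φ.guard_iff d _).1 hg
    · rintro ⟨b', v⟩ hbv
      obtain ⟨b, rfl, hb⟩ := exists_of_mem_preFlow_mono φ hO hbv
      rw [hφ.glueAssign_mapT]
      refine (hpre _ hb).trans ?_
      rcases hD.mem_cut_or_mem_postConds d.2 hb with hbcut | ⟨d', hd', w, hw⟩
      · rw [valOf_glueAssign hO _ _ (hφ.mem_cut hbcut).1]
        exact hcut b hbcut
      · obtain ⟨d', rfl⟩ : ∃ a, O.arTVal C1 D a = d' := ⟨⟨d', hd'⟩, rfl⟩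
        rw [hO.valOf_of_mem_postFlow (mem_postFlow_mono φ hO hC2 hw), hφ.glueAssign_mapT]
        exact hO.valOf_of_mem_postFlow hw ι1

end Glue

theorem Safe.eq_of_mem {M : N.Marking} (hsafe : N.Safe) (hM : N.Reach M) {p : N.Place}
    {c c' : Color} (hc : (p, c) ∈ M) (hc' : (p, c') ∈ M) : c = c' := by
  have hmem : ∀ a, (p, a) ∈ M → (p, a) ∈ M.filter fun pc => pc.1 = p :=
    fun a ha => Multiset.mem_filter.2 ⟨ha, rfl⟩
  rcases Nat.le_one_iff_eq_zero_or_eq_one.1 (hsafe M hM p) with h0 | h1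
  · exact absurd (hmem c hc) (by simp [Multiset.card_eq_zero.1 h0])
  · obtain ⟨x, hx⟩ := Multiset.card_eq_one.1 h1
    have h1 := hmem c hc
    have h2 := hmem c' hc'
    rw [hx, Multiset.mem_singleton] at h1 h2
    exact (Prod.ext_iff.1 (h1.trans h2.symm)).2

theorem mem_mark {h : Hom O N} {C : Set O.Trans} (hfin : (O.cut C).Finite) (ι : O.Assign)
    {b : O.Place} (hb : b ∈ O.cut C) : (h.mapP b, O.valOf ι b) ∈ mark h hfin ι :=
  Multiset.mem_map.2 ⟨b, hfin.mem_toFinset.2 hb, rfl⟩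

section Inverse

variable {C1 C2 D : Set O.Trans} {φ : Hom (O.around C1 D) (O.future C2)} {h : Hom O N}

theorem IsCanonMono.mem_aroundPlaces (hφ : IsCanonMono h C1 D C2 φ) (hO : O.IsOccNet)
    (hC2 : O.IsConfig C2) (b : (O.around C1 D).Place) :
    O.futPVal C2 (φ.mapP b) ∈ O.aroundPlaces C2 (monoImageD C1 D C2 φ) := by
  rcases b.2 with (hb | ⟨d, hd, v, hb⟩) | ⟨d, hd, v, hb⟩
  · exact Or.inl (Or.inl (hφ.mem_cut hb))
  · exact Or.inl (Or.inr ⟨_, monoImageD_mem φ ⟨d, hd⟩, v, mem_preFlow_mono φ hO hb⟩)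
  · exact Or.inr ⟨_, monoImageD_mem φ ⟨d, hd⟩, v, mem_postFlow_mono φ hO hC2 hb⟩

theorem IsCanonMono.exists_of_mem_aroundPlaces (hφ : IsCanonMono h C1 D C2 φ)
    (hO : O.IsOccNet) (hC2 : O.IsConfig C2) {b' : O.Place}
    (hb' : b' ∈ O.aroundPlaces C2 (monoImageD C1 D C2 φ)) :
    ∃ b, O.futPVal C2 (φ.mapP b) = b' := by
  rcases hb' with (hb' | ⟨_, ⟨d, rfl⟩, v, hb'⟩) | ⟨_, ⟨d, rfl⟩, v, hb'⟩
  · rw [← hφ.2.2.2.2] at hb'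
    obtain ⟨b, -, hb⟩ := hb'
    exact ⟨b, hb⟩
  · obtain ⟨b, hb, -⟩ := exists_of_mem_preFlow_mono φ hO hb'
    exact ⟨b, hb⟩
  · obtain ⟨b, hb, -⟩ := exists_of_mem_postFlow_mono φ hO hC2 hb'
    exact ⟨b, hb⟩

/-- The bijection between the conditions of `O(C1|D)` and of `O(C2|φ(D))` induced by `φ`. -/
def IsCanonMono.placeEquiv (hφ : IsCanonMono h C1 D C2 φ) (hO : O.IsOccNet)
    (hC2 : O.IsConfig C2) :
    (O.around C1 D).Place ≃ (O.around C2 (monoImageD C1 D C2 φ)).Place :=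
  Equiv.ofBijective (fun b => ⟨O.futPVal C2 (φ.mapP b), hφ.mem_aroundPlaces hO hC2 b⟩)
    ⟨fun _ _ hab => by
      have hval := congrArg (O.arPVal C2 (monoImageD C1 D C2 φ)) hab
      exact hφ.futPVal_comp_injective hval, fun b' =>
      (hφ.exists_of_mem_aroundPlaces hO hC2 b'.2).imp fun _ hb => Subtype.ext hb⟩

/-- The bijection between `D` and `φ(D)` induced by `φ`. -/
def IsCanonMono.eventEquiv (hφ : IsCanonMono h C1 D C2 φ) :
    (O.around C1 D).Trans ≃ (O.around C2 (monoImageD C1 D C2 φ)).Trans :=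
  Equiv.ofBijective (fun d => ⟨O.futTVal C2 (φ.mapT d), monoImageD_mem φ d⟩)
    ⟨fun _ _ hab => by
      have hval := congrArg (O.arTVal C2 (monoImageD C1 D C2 φ)) hab
      exact hφ.futTVal_comp_injective hval, fun e =>
      e.2.imp fun _ hd => Subtype.ext hd⟩

theorem IsCanonMono.arPVal_placeEquiv (hφ : IsCanonMono h C1 D C2 φ) (hO : O.IsOccNet)
    (hC2 : O.IsConfig C2) (b : (O.around C1 D).Place) :
    O.arPVal C2 (monoImageD C1 D C2 φ) (hφ.placeEquiv hO hC2 b) = O.futPVal C2 (φ.mapP b) :=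
  rfl

theorem IsCanonMono.arTVal_eventEquiv (hφ : IsCanonMono h C1 D C2 φ)
    (d : (O.around C1 D).Trans) :
    O.arTVal C2 (monoImageD C1 D C2 φ) (hφ.eventEquiv d) = O.futTVal C2 (φ.mapT d) :=
  rfl

theorem IsCanonMono.preFlow_eventEquiv (hφ : IsCanonMono h C1 D C2 φ) (hO : O.IsOccNet)
    (hC2 : O.IsConfig C2) (d : (O.around C1 D).Trans) :
    (O.around C2 (monoImageD C1 D C2 φ)).preFlow (hφ.eventEquiv d) =
      ((O.around C1 D).preFlow d).map fun x => (hφ.placeEquiv hO hC2 x.1, x.2) := by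
  refine map_injective_of_fst arPVal_injective ?_
  refine (map_val_around_preFlow (hφ.eventEquiv d)).trans ?_
  rw [hφ.arTVal_eventEquiv, preFlow_mono φ hO, Multiset.map_map]
  rfl

theorem IsCanonMono.postFlow_eventEquiv (hφ : IsCanonMono h C1 D C2 φ) (hO : O.IsOccNet)
    (hC2 : O.IsConfig C2) (d : (O.around C1 D).Trans) :
    (O.around C2 (monoImageD C1 D C2 φ)).postFlow (hφ.eventEquiv d) =
      ((O.around C1 D).postFlow d).map fun x => (hφ.placeEquiv hO hC2 x.1, x.2) := by
  refine map_injective_of_fst arPVal_injective ?_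
  refine (map_val_around_postFlow (hφ.eventEquiv d)).trans ?_
  rw [hφ.arTVal_eventEquiv, postFlow_mono φ hO hC2, Multiset.map_map]
  rfl

/-- The inverse of `φ`, as a homomorphism from `O(C2|φ(D))` to `↑C1`. -/
def IsCanonMono.inverse (hφ : IsCanonMono h C1 D C2 φ) (hO : O.IsOccNet)
    (hC1 : O.IsConfig C1) (hC2 : O.IsConfig C2) (hD : O.IsSuffix C1 D) :
    Hom (O.around C2 (monoImageD C1 D C2 φ)) (O.future C1) where
  mapP b' := ⟨O.arPVal C1 D ((hφ.placeEquiv hO hC2).symm b'),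
    hD.aroundPlaces_subset hO hC1 ((hφ.placeEquiv hO hC2).symm b').2⟩
  mapT e := ⟨O.arTVal C1 D (hφ.eventEquiv.symm e),
    hD.mem_futureEvents (hφ.eventEquiv.symm e).2⟩
  guard_iff e σ := by
    obtain ⟨d, rfl⟩ := hφ.eventEquiv.surjective e
    simp only [Equiv.symm_apply_apply]
    exact (φ.guard_iff d σ).symm
  pre_eq e := by
    obtain ⟨d, rfl⟩ := hφ.eventEquiv.surjective e
    refine map_injective_of_fst futPVal_injective ?_
    refine (map_val_future_preFlow hO _).trans ?_
    rw [hφ.preFlow_eventEquiv hO hC2, Multiset.map_map, Multiset.map_map]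
    refine (congrArg (fun a => O.preFlow (O.arTVal C1 D a))
      (hφ.eventEquiv.symm_apply_apply d)).trans ?_
    rw [← map_val_around_preFlow]
    exact Multiset.map_congr rfl fun x _ => Prod.ext
      (congrArg (O.arPVal C1 D) ((hφ.placeEquiv hO hC2).symm_apply_apply x.1)).symm rfl
  post_eq e := by
    obtain ⟨d, rfl⟩ := hφ.eventEquiv.surjective e
    refine map_injective_of_fst futPVal_injective ?_
    refine (map_val_future_postFlow hO hC1 _).trans ?_
    rw [hφ.postFlow_eventEquiv hO hC2, Multiset.map_map, Multiset.map_map]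
    refine (congrArg (fun a => O.postFlow (O.arTVal C1 D a))
      (hφ.eventEquiv.symm_apply_apply d)).trans ?_
    rw [← map_val_around_postFlow]
    exact Multiset.map_congr rfl fun x _ => Prod.ext
      (congrArg (O.arPVal C1 D) ((hφ.placeEquiv hO hC2).symm_apply_apply x.1)).symm rfl

variable (hφ : IsCanonMono h C1 D C2 φ) (hO : O.IsOccNet)
    (hC1 : O.IsConfig C1) (hC2 : O.IsConfig C2) (hD : O.IsSuffix C1 D)

theorem IsCanonMono.futPVal_inverse (b : (O.around C1 D).Place) :
    O.futPVal C1 ((hφ.inverse hO hC1 hC2 hD).mapP (hφ.placeEquiv hO hC2 b)) =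
      O.arPVal C1 D b :=
  congrArg (O.arPVal C1 D) ((hφ.placeEquiv hO hC2).symm_apply_apply b)

theorem IsCanonMono.futTVal_inverse (d : (O.around C1 D).Trans) :
    O.futTVal C1 ((hφ.inverse hO hC1 hC2 hD).mapT (hφ.eventEquiv d)) = O.arTVal C1 D d :=
  congrArg (O.arTVal C1 D) (hφ.eventEquiv.symm_apply_apply d)

theorem IsCanonMono.isCanonMono_inverse :
    IsCanonMono h C2 (monoImageD C1 D C2 φ) C1 (hφ.inverse hO hC1 hC2 hD) := by
  refine ⟨fun a b hab => ?_, fun a b hab => ?_, fun b' => ?_, fun e => ?_, ?_⟩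
  · have hval := congrArg (O.futPVal C1) hab
    exact (hφ.placeEquiv hO hC2).symm.injective (arPVal_injective hval)
  · have hval := congrArg (O.futTVal C1) hab
    exact hφ.eventEquiv.symm.injective (arTVal_injective hval)
  · obtain ⟨b, rfl⟩ := (hφ.placeEquiv hO hC2).surjective b'
    rw [hφ.futPVal_inverse, hφ.arPVal_placeEquiv, hφ.2.2.1]
  · obtain ⟨d, rfl⟩ := hφ.eventEquiv.surjective e
    rw [hφ.futTVal_inverse, hφ.arTVal_eventEquiv, hφ.2.2.2.1]
  · ext b
    constructor
    · rintro ⟨b', hb', rfl⟩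
      obtain ⟨b, rfl⟩ := (hφ.placeEquiv hO hC2).surjective b'
      rw [Set.mem_ofPred_eq, hφ.arPVal_placeEquiv, ← hφ.2.2.2.2] at hb'
      obtain ⟨a, ha, hab⟩ := hb'
      obtain rfl := hφ.futPVal_comp_injective hab
      beta_reduce
      rw [hφ.futPVal_inverse]
      exact ha
    · intro hb
      exact ⟨hφ.placeEquiv hO hC2 ⟨b, Or.inl (Or.inl hb)⟩, hφ.mem_cut hb,
        hφ.futPVal_inverse hO hC1 hC2 hD _⟩

theorem IsCanonMono.monoImageD_inverse :
    monoImageD C2 (monoImageD C1 D C2 φ) C1 (hφ.inverse hO hC1 hC2 hD) = D := by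
  ext d
  constructor
  · rintro ⟨e, rfl⟩
    exact (hφ.eventEquiv.symm e).2
  · exact fun hd => ⟨hφ.eventEquiv ⟨d, hd⟩, hφ.futTVal_inverse hO hC1 hC2 hD _⟩

end Inverse

end HLNet

/-- Let `≺` be an adequate order on the finite configurations of the
symbolic unfolding of a safe high-level Petri net. Let `C1, C2` be finite
configurations, `D` a suffix of `C1`, and `M ∈ Marks(C1) ∩ Marks(C2)` a marking with
`C1⟦M⟧D`, and let `φ` be the unique label-preserving monomorphism from `O(C1|D)` into
`↑C2` with `φ(Cut(C1)) = Cut(C2)`. Then `C2 ≺ C1` implies `C2 ⊕ φ(D) ≺ C1 ⊕ D`. -/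
theorem adequate_order_preserved_in_reverse {Color Var : Type} (N O : HLNet Color Var)
    (h : HLNet.Hom O N) (hsafe : N.Safe) (hU : HLNet.IsUnfolding h)
    (r : Set O.Trans → Set O.Trans → Prop) (hr : HLNet.IsAdequate h r)
    (C1 C2 D : Set O.Trans) (h1 : O.FinCfg C1) (h2 : O.FinCfg C2)
    (hD : O.IsSuffix C1 D) (hDfin : D.Finite) (M : N.Marking)
    (hM1 : M ∈ HLNet.marks h C1) (hM2 : M ∈ HLNet.marks h C2)
    (hrel : HLNet.markRel h C1 M D)
    (φ : HLNet.Hom (O.around C1 D) (O.future C2))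
    (hφ : HLNet.IsCanonMono h C1 D C2 φ) :
    r C2 C1 → r (C2 ∪ HLNet.monoImageD C1 D C2 φ) (C1 ∪ D) := by
  intro hlt
  have hO := hU.1.1
  obtain ⟨ι1, hι1, hfin1, hmark1⟩ := hrel
  obtain ⟨ι2, hι2, hfin2, hmark2⟩ := hM2
  have hreach : N.Reach M := by
    obtain ⟨_, hreach⟩ := HLNet.reach_mark hO hU.1.2.1 h2 hι2
    exact hmark2 ▸ hreach
  have hcut : ∀ b, O.arPVal C1 D b ∈ O.cut C1 →
      O.valOf ι1 (O.arPVal C1 D b) = O.valOf ι2 (O.futPVal C2 (φ.mapP b)) := by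
    intro b hb
    have hm1 := HLNet.mem_mark (h := h) hfin1 ι1 hb
    have hm2 := HLNet.mem_mark (h := h) hfin2 ι2 (hφ.mem_cut hb)
    rw [hmark1] at hm1
    rw [← hmark2, hφ.2.2.1] at hm2
    exact hsafe.eq_of_mem hreach hm1 hm2
  have hglue := hφ.isInst_glueAssign hO h2.1 hD hι1 hι2 hcut
  have hsuffix : O.IsSuffix C2 (HLNet.monoImageD C1 D C2 φ) :=
    ⟨HLNet.disjoint_monoImageD φ, hφ.causally_closed hO h2.1 hD,
      hφ.conflict_free hO h2.1 hD, _, hglue⟩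
  have key := hr.2.2.2.2 C2 C1 _ M h2 h1 hsuffix (HLNet.monoImageD_finite φ hDfin)
    ⟨ι2, hι2, hfin2, hmark2⟩ hM1
    ⟨_, hglue, hfin2, (HLNet.mark_glueAssign hO ι1 ι2 hfin2).trans hmark2.symm⟩
    (hφ.inverse hO h1.1 h2.1 hD) (hφ.isCanonMono_inverse hO h1.1 h2.1 hD) hlt
  rwa [hφ.monoImageD_inverse hO h1.1 h2.1 hD] at key
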